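/- arXiv:1108.5237 — 2 statements merged into one kernel-verified Lean document; each statement's English description precedes it below -/
import Mathlib

section
/- Let X be a complex Banach space and let F : ℝ → X be absolutely regular such that for every h > 0 the function M_h F(t) = (1/h)∫₀^h F(t+s) ds is bounded on ℝ. Suppose that for every ω ∈ ℝ there exists a Schwartz function φ with φ̂(ω) ≠ 0 such that F∗φ ∈ C₀(ℝ,X). Then F∗ψ ∈ C₀(ℝ,X) for every Schwartz function ψ. -/
open MeasureTheory Filter Topology

/-- The Fourier transform `f̂(ω) = ∫ e^{-iωt} f(t) dt` of an integrable function. -/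
noncomputable def fourierInt (f : ℝ → ℂ) (ω : ℝ) : ℂ :=
  ∫ t : ℝ, Complex.exp (-(Complex.I * ω * t)) * f t

/-- A function `F : ℝ → X` is absolutely regular: strongly measurable, locally Bochner
integrable, and `t ↦ φ(t) • F(t)` is Bochner integrable for every Schwartz `φ`. -/
def AbsolutelyRegular {X : Type*} [NormedAddCommGroup X] [NormedSpace ℂ X]
    (F : ℝ → X) : Prop :=
  StronglyMeasurable F ∧ LocallyIntegrable F ∧
    ∀ φ : SchwartzMap ℝ ℂ, Integrable (fun t => φ t • F t)

/-- The convolution `(F∗φ)(t) = ∫ φ(t−s) • F(s) ds`. -/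
noncomputable def convS {X : Type*} [NormedAddCommGroup X] [NormedSpace ℂ X]
    (φ : ℝ → ℂ) (F : ℝ → X) (t : ℝ) : X :=
  ∫ s : ℝ, φ (t - s) • F s

/-- `F ∈ C₀(ℝ,X)`: continuous and `‖F(t)‖ → 0` as `|t| → ∞`. -/
def IsCZero {X : Type*} [NormedAddCommGroup X] (F : ℝ → X) : Prop :=
  Continuous F ∧ Tendsto (fun t => ‖F t‖) (cocompact ℝ) (𝓝 0)

section Primitive

variable {X : Type*} [NormedAddCommGroup X] [NormedSpace ℂ X]

/-- If all increments of the primitive of `F` over intervals of a fixed length are bounded, then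
the primitive has at most affine growth, uniformly in the base point. -/
theorem exists_norm_intervalIntegral_le_of_bounded_mean {F : ℝ → X} (hF : LocallyIntegrable F)
    (hM : ∀ h : ℝ, 0 < h → ∃ C : ℝ, ∀ t : ℝ, ‖h⁻¹ • ∫ s in (0:ℝ)..h, F (t + s)‖ ≤ C) :
    ∃ B : ℝ, 0 ≤ B ∧ ∀ a b : ℝ, ‖∫ s in a..b, F s‖ ≤ B * (1 + |b - a|) := by
  have hI : ∀ a b, IntervalIntegrable F volume a b := fun a b =>
    (hF.integrableOn_isCompact isCompact_uIcc).intervalIntegrable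
  have hpos : ∀ h : ℝ, 0 < h → ∃ C : ℝ, ∀ t : ℝ, ‖∫ s in t..(t + h), F s‖ ≤ C := by
    intro h hh
    obtain ⟨C, hC⟩ := hM h hh
    refine ⟨h * C, fun t => ?_⟩
    have := hC t
    rw [intervalIntegral.integral_comp_add_left (fun s => F s) t, norm_smul, add_zero,
      Real.norm_of_nonneg (inv_nonneg.2 hh.le)] at this
    rwa [inv_mul_le_iff₀ hh] at this
  have hall : ∀ h : ℝ, ∃ C : ℝ, ∀ t : ℝ, ‖∫ s in t..(t + h), F s‖ ≤ C := by
    intro h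
    rcases lt_trichotomy h 0 with hh | rfl | hh
    · obtain ⟨C, hC⟩ := hpos (-h) (by linarith)
      refine ⟨C, fun t => ?_⟩
      have := hC (t + h)
      rw [intervalIntegral.integral_symm, norm_neg]
      simpa using this
    · exact ⟨0, fun t => by simp⟩
    · exact hpos h hh
  let A : ℕ → Set ℝ := fun n => {h | ∀ t : ℝ, ‖∫ s in t..(t + h), F s‖ ≤ n}
  have hA_closed : ∀ n, IsClosed (A n) := by
    intro n
    have : A n = ⋂ t : ℝ, {h | ‖∫ s in t..(t + h), F s‖ ≤ n} := by ext; simp [A]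
    rw [this]
    refine isClosed_iInter fun t => isClosed_le ?_ continuous_const
    exact ((intervalIntegral.continuous_primitive hI t).comp
      (continuous_const.add continuous_id)).norm
  have hA_cover : ⋃ n, A n = Set.univ := by
    refine Set.eq_univ_of_forall fun h => ?_
    obtain ⟨C, hC⟩ := hall h
    obtain ⟨n, hn⟩ := exists_nat_ge C
    exact Set.mem_iUnion.2 ⟨n, fun t => (hC t).trans hn⟩
  obtain ⟨n, h₀, hh₀⟩ := nonempty_interior_of_iUnion_of_closed hA_closed hA_cover
  obtain ⟨δ, hδ, hball⟩ := Metric.isOpen_iff.1 isOpen_interior h₀ hh₀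
  have hsmall : ∀ k : ℝ, |k| < δ → ∀ t, ‖∫ s in t..(t + k), F s‖ ≤ 2 * n := by
    intro k hk t
    have h1 : ‖∫ s in t..(t + (h₀ + k)), F s‖ ≤ n :=
      interior_subset (hball (by simpa [Real.dist_eq] using hk)) t
    have h2 : ‖∫ s in (t + k)..(t + k + h₀), F s‖ ≤ n := interior_subset hh₀ (t + k)
    have h3 : ∫ s in t..(t + k), F s
        = (∫ s in t..(t + (h₀ + k)), F s) - ∫ s in (t + k)..(t + k + h₀), F s := by
      rw [show t + (h₀ + k) = t + k + h₀ by ring, eq_sub_iff_add_eq,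
        intervalIntegral.integral_add_adjacent_intervals (hI _ _) (hI _ _)]
    rw [h3]
    linarith [norm_sub_le (∫ s in t..(t + (h₀ + k)), F s) (∫ s in (t + k)..(t + k + h₀), F s)]
  have hmul : ∀ k : ℝ, |k| < δ → ∀ t, ∀ m : ℕ,
      ‖∫ s in t..(t + m * k), F s‖ ≤ m * (2 * n) := by
    intro k hk t m
    induction m with
    | zero => simp
    | succ m ih =>
      have h1 := hsmall k hk (t + m * k)
      have h2 : ∫ s in t..(t + (m + 1 : ℕ) * k), F s
          = (∫ s in t..(t + m * k), F s) + ∫ s in (t + m * k)..(t + m * k + k), F s := by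
        rw [intervalIntegral.integral_add_adjacent_intervals (hI _ _) (hI _ _)]
        congr 1
        push_cast
        ring
      rw [h2]
      refine (norm_add_le _ _).trans ?_
      push_cast
      linarith
  refine ⟨2 * n * (1 + δ⁻¹), by positivity, fun a b => ?_⟩
  set m : ℕ := ⌊|b - a| / δ⌋₊ + 1 with hm
  have hm0 : (0 : ℝ) < m := by positivity
  have hm1 : |b - a| / δ < m := by
    rw [hm]; push_cast; exact Nat.lt_floor_add_one _
  have hm2 : (m : ℝ) ≤ |b - a| / δ + 1 := by
    rw [hm]; push_cast; linarith [Nat.floor_le (show 0 ≤ |b - a| / δ by positivity)]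
  have hk : |(b - a) / m| < δ := by
    rw [abs_div, abs_of_pos hm0, div_lt_iff₀ hm0]
    rw [div_lt_iff₀ hδ] at hm1
    linarith
  have := hmul _ hk a m
  rw [mul_div_cancel₀ _ hm0.ne', add_sub_cancel] at this
  refine this.trans ?_
  have h5 : (m : ℝ) * (2 * n) ≤ (|b - a| / δ + 1) * (2 * n) := by gcongr
  refine h5.trans ?_
  have h6 : |b - a| / δ + 1 ≤ (1 + δ⁻¹) * (1 + |b - a|) := by
    rw [div_eq_mul_inv]
    nlinarith [abs_nonneg (b - a), inv_pos.2 hδ]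
  nlinarith [show (0 : ℝ) ≤ 2 * n by positivity]

/-- Integration by parts against the primitive of a locally integrable function. -/
theorem intervalIntegral_smul_eq_sub_integral_deriv_smul [CompleteSpace X] {F : ℝ → X}
    (hF : LocallyIntegrable F) {g g' : ℝ → ℂ} (hg : ∀ x, HasDerivAt g (g' x) x)
    (hg' : Continuous g') {a b : ℝ} (hab : a ≤ b) (c : ℝ) :
    ∫ s in a..b, g s • F s = g b • (∫ s in c..b, F s) - g a • (∫ s in c..a, F s)
      - ∫ v in a..b, g' v • ∫ s in c..v, F s := by
  have hI : ∀ a b, IntervalIntegrable F volume a b := fun a b =>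
    (hF.integrableOn_isCompact isCompact_uIcc).intervalIntegrable
  have hgc : Continuous g := continuous_iff_continuousAt.2 fun x => (hg x).continuousAt
  have hgF : IntervalIntegrable (fun s => g s • F s) volume a b :=
    (hI a b).continuousOn_smul hgc.continuousOn
  have hFTC : ∀ s, ∫ v in s..b, g' v = g b - g s := fun s =>
    intervalIntegral.integral_eq_sub_of_hasDerivAt (fun x _ => hg x)
      (hg'.intervalIntegrable _ _)
  let μ : Measure ℝ := volume.restrict (Set.Ioc a b)
  have hint : Integrable (fun p : ℝ × ℝ => g' p.1 • F p.2) (μ.prod μ) := by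
    refine Integrable.smul_prod ?_ ?_
    · exact (hg'.integrableOn_Ioc)
    · exact (hF.integrableOn_isCompact isCompact_Icc).mono_set Set.Ioc_subset_Icc_self
  have hS : MeasurableSet {p : ℝ × ℝ | p.2 < p.1} := measurableSet_lt measurable_snd measurable_fst
  have hswap := integral_integral_swap
    (f := fun v s => Set.indicator {p : ℝ × ℝ | p.2 < p.1} (fun p => g' p.1 • F p.2) (v, s))
    (hint.indicator hS)
  have hL : ∀ v ∈ Set.Ioc a b,
      ∫ s, Set.indicator {p : ℝ × ℝ | p.2 < p.1} (fun p => g' p.1 • F p.2) (v, s) ∂μ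
        = g' v • ∫ s in a..v, F s := by
    intro v hv
    have : (fun s => Set.indicator {p : ℝ × ℝ | p.2 < p.1} (fun p => g' p.1 • F p.2) (v, s))
        = Set.indicator (Set.Iio v) (fun s => g' v • F s) := by
      ext s; simp [Set.indicator]
    rw [this, integral_indicator measurableSet_Iio, Measure.restrict_restrict measurableSet_Iio,
      show Set.Iio v ∩ Set.Ioc a b = Set.Ioo a v by
        ext x; simp only [Set.mem_inter_iff, Set.mem_Iio, Set.mem_Ioc, Set.mem_Ioo]
        constructor
        · rintro ⟨h1, h2, h3⟩; exact ⟨h2, h1⟩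
        · rintro ⟨h1, h2⟩; exact ⟨h2, h1, h2.le.trans hv.2⟩,
      ← integral_Ioc_eq_integral_Ioo, integral_smul, intervalIntegral.integral_of_le hv.1.le]
  have hR : ∀ s ∈ Set.Ioc a b,
      ∫ v, Set.indicator {p : ℝ × ℝ | p.2 < p.1} (fun p => g' p.1 • F p.2) (v, s) ∂μ
        = (g b - g s) • F s := by
    intro s hs
    have : (fun v => Set.indicator {p : ℝ × ℝ | p.2 < p.1} (fun p => g' p.1 • F p.2) (v, s))
        = Set.indicator (Set.Ioi s) (fun v => g' v • F s) := by
      ext v; simp [Set.indicator]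
    rw [this, integral_indicator measurableSet_Ioi, Measure.restrict_restrict measurableSet_Ioi,
      show Set.Ioi s ∩ Set.Ioc a b = Set.Ioc s b by
        ext x; simp only [Set.mem_inter_iff, Set.mem_Ioi, Set.mem_Ioc]
        constructor
        · rintro ⟨h1, h2, h3⟩; exact ⟨h1, h3⟩
        · rintro ⟨h1, h2⟩; exact ⟨h1, hs.1.trans h1, h2⟩,
      integral_smul_const, ← intervalIntegral.integral_of_le hs.2, hFTC]
  rw [setIntegral_congr_fun measurableSet_Ioc hL, setIntegral_congr_fun measurableSet_Ioc hR,
    ← intervalIntegral.integral_of_le hab, ← intervalIntegral.integral_of_le hab] at hswap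
  have hcont : ∀ c, Continuous fun v => ∫ s in c..v, F s :=
    fun c => intervalIntegral.continuous_primitive hI c
  have e1 : ∫ s in a..b, (g b - g s) • F s
      = g b • (∫ s in a..b, F s) - ∫ s in a..b, g s • F s := by
    simp_rw [sub_smul]
    rw [intervalIntegral.integral_sub ((hI a b).continuousOn_smul continuousOn_const) hgF,
      intervalIntegral.integral_smul]
  have e2 : ∀ v, ∫ s in c..v, F s = (∫ s in c..a, F s) + ∫ s in a..v, F s := fun v =>
    (intervalIntegral.integral_add_adjacent_intervals (hI _ _) (hI _ _)).symm
  have e3 : ∫ v in a..b, g' v • ∫ s in c..v, F s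
      = (g b - g a) • (∫ s in c..a, F s) + ∫ v in a..b, g' v • ∫ s in a..v, F s := by
    rw [intervalIntegral.integral_congr (g := fun v =>
        g' v • (∫ s in c..a, F s) + g' v • ∫ s in a..v, F s)
        fun v _ => by simp only [e2 v, smul_add],
      intervalIntegral.integral_add, intervalIntegral.integral_smul_const, hFTC]
    · exact (hg'.smul continuous_const).intervalIntegrable _ _
    · exact (hg'.smul (hcont a)).intervalIntegrable _ _
  rw [e3, hswap, e1, e2 b, sub_smul, smul_add]
  abel

end Primitive

section Convolution

variable {X : Type*} [NormedAddCommGroup X] [NormedSpace ℂ X]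

theorem AbsolutelyRegular.integrable_sub_smul {F : ℝ → X} (hF : AbsolutelyRegular F)
    (φ : SchwartzMap ℝ ℂ) (t : ℝ) : Integrable fun s => φ (t - s) • F s := by
  have := hF.2.2 (SchwartzMap.compSubConstCLM ℂ t
    (SchwartzMap.compCLMOfContinuousLinearEquiv ℂ (ContinuousLinearEquiv.neg ℝ) φ))
  simpa using this

theorem AbsolutelyRegular.tendsto_intervalIntegral_convS {F : ℝ → X} (hF : AbsolutelyRegular F)
    (φ : SchwartzMap ℝ ℂ) (t : ℝ) :
    Tendsto (fun n : ℕ => ∫ s in (-(n : ℝ))..n, φ (t - s) • F s) atTop (𝓝 (convS φ F t)) :=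
  intervalIntegral_tendsto_integral (hF.integrable_sub_smul φ t)
    (tendsto_neg_atTop_atBot.comp tendsto_natCast_atTop_atTop) tendsto_natCast_atTop_atTop

theorem SchwartzMap.exists_norm_mul_one_add_abs_le (φ : SchwartzMap ℝ ℂ) :
    ∃ M : ℝ, 0 ≤ M ∧ ∀ u, ‖φ u‖ * (1 + |u|) ≤ M := by
  obtain ⟨C₀, h₀, hC₀⟩ := φ.decay 0 0
  obtain ⟨C₁, h₁, hC₁⟩ := φ.decay 1 0
  refine ⟨C₀ + C₁, by positivity, fun u => ?_⟩
  have h2 := hC₀ u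
  have h3 := hC₁ u
  simp only [pow_zero, one_mul, norm_iteratedFDeriv_zero, pow_one, Real.norm_eq_abs] at h2 h3
  linarith

theorem SchwartzMap.integrable_norm_mul_one_add_abs (φ : SchwartzMap ℝ ℂ) :
    Integrable fun u => ‖φ u‖ * (1 + |u|) := by
  have h := φ.integrable.norm.add (φ.integrable_pow_mul volume 1)
  refine h.congr (.of_forall fun u => ?_)
  simp only [Pi.add_apply, Real.norm_eq_abs, pow_one]
  ring

/-- Truncated convolutions of a Schwartz function with a function whose primitive has affine
growth are bounded, uniformly in the truncation. -/
theorem exists_norm_intervalIntegral_sub_smul_le [CompleteSpace X] {F : ℝ → X}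
    (hF : LocallyIntegrable F) {B : ℝ} (hB0 : 0 ≤ B)
    (hB : ∀ a b : ℝ, ‖∫ s in a..b, F s‖ ≤ B * (1 + |b - a|)) (φ : SchwartzMap ℝ ℂ) :
    ∃ K : ℝ, ∀ t a b : ℝ, a ≤ b → ‖∫ s in a..b, φ (t - s) • F s‖ ≤ K := by
  obtain ⟨M, hM0, hM⟩ := φ.exists_norm_mul_one_add_abs_le
  let ψ := SchwartzMap.derivCLM ℂ ℂ φ
  have hψ := ψ.integrable_norm_mul_one_add_abs
  refine ⟨B * M + B * M + B * ∫ u, ‖ψ u‖ * (1 + |u|), fun t a b hab => ?_⟩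
  have hg : ∀ x, HasDerivAt (fun s => φ (t - s)) (-ψ (t - x)) x := by
    intro x
    have h1 : HasDerivAt φ (ψ (t - x)) (t - x) := by
      simpa [ψ] using φ.differentiableAt.hasDerivAt
    simpa [Function.comp_def] using h1.scomp x ((hasDerivAt_id x).const_sub t)
  have hg' : Continuous fun x => -ψ (t - x) :=
    (ψ.continuous.comp (continuous_const.sub continuous_id)).neg
  rw [intervalIntegral_smul_eq_sub_integral_deriv_smul hF hg hg' hab t]
  have hterm : ∀ x, ‖φ (t - x) • ∫ s in t..x, F s‖ ≤ B * M := by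
    intro x
    rw [norm_smul]
    calc ‖φ (t - x)‖ * ‖∫ s in t..x, F s‖ ≤ ‖φ (t - x)‖ * (B * (1 + |x - t|)) := by
          gcongr; exact hB _ _
      _ = B * (‖φ (t - x)‖ * (1 + |t - x|)) := by rw [abs_sub_comm]; ring
      _ ≤ B * M := by gcongr; exact hM _
  have hψt : Integrable fun v => B * (‖ψ (t - v)‖ * (1 + |t - v|)) :=
    (hψ.comp_sub_left t).const_mul B
  have hint : ‖∫ v in a..b, (-ψ (t - v)) • ∫ s in t..v, F s‖
      ≤ B * ∫ u, ‖ψ u‖ * (1 + |u|) := by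
    calc ‖∫ v in a..b, (-ψ (t - v)) • ∫ s in t..v, F s‖
        ≤ ∫ v in a..b, B * (‖ψ (t - v)‖ * (1 + |t - v|)) := by
          refine intervalIntegral.norm_integral_le_of_norm_le hab (.of_forall fun v _ => ?_)
            hψt.intervalIntegrable
          rw [norm_smul, norm_neg]
          calc ‖ψ (t - v)‖ * ‖∫ s in t..v, F s‖ ≤ ‖ψ (t - v)‖ * (B * (1 + |v - t|)) := by
                gcongr; exact hB _ _
            _ = B * (‖ψ (t - v)‖ * (1 + |t - v|)) := by rw [abs_sub_comm]; ring
      _ ≤ ∫ v, B * (‖ψ (t - v)‖ * (1 + |t - v|)) := by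
          rw [intervalIntegral.integral_of_le hab]
          exact setIntegral_le_integral hψt (.of_forall fun v => by positivity)
      _ = B * ∫ u, ‖ψ u‖ * (1 + |u|) := by
          rw [integral_const_mul]
          congr 1
          exact integral_sub_left_eq_self (fun u => ‖ψ u‖ * (1 + |u|)) volume t
  refine (norm_sub_le _ _).trans (add_le_add ((norm_sub_le _ _).trans ?_) hint)
  exact add_le_add (hterm b) (hterm a)

/-- `F` is absolutely regular and its convolutions with any fixed Schwartz function, truncated to
bounded intervals, are uniformly bounded. -/
structure IsMeanBounded (F : ℝ → X) : Prop where
  regular : AbsolutelyRegular F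
  exists_bound : ∀ φ : SchwartzMap ℝ ℂ, ∃ K : ℝ, ∀ t a b : ℝ, a ≤ b →
    ‖∫ s in a..b, φ (t - s) • F s‖ ≤ K

namespace IsMeanBounded

variable {F : ℝ → X}

theorem exists_norm_convS_le (hF : IsMeanBounded F) (φ : SchwartzMap ℝ ℂ) :
    ∃ K : ℝ, ∀ t, ‖convS φ F t‖ ≤ K := by
  obtain ⟨K, hK⟩ := hF.exists_bound φ
  refine ⟨K, fun t => le_of_tendsto (hF.regular.tendsto_intervalIntegral_convS φ t).norm
    (.of_forall fun n => hK t _ _ ?_)⟩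
  linarith [Nat.cast_nonneg (α := ℝ) n]

theorem hasDerivAt_intervalIntegral (hF : LocallyIntegrable F) (φ : SchwartzMap ℝ ℂ)
    (a b t : ℝ) :
    HasDerivAt (fun t => ∫ s in a..b, φ (t - s) • F s)
      (∫ s in a..b, (SchwartzMap.derivCLM ℂ ℂ φ) (t - s) • F s) t := by
  have hI : IntervalIntegrable F volume a b :=
    (hF.integrableOn_isCompact isCompact_uIcc).intervalIntegrable
  have hφ : ∀ (η : SchwartzMap ℝ ℂ) t, IntervalIntegrable (fun s => η (t - s) • F s) volume a b :=
    fun η t => hI.continuousOn_smul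
      (η.continuous.comp (continuous_const.sub continuous_id)).continuousOn
  obtain ⟨M, hM0, hM⟩ := (SchwartzMap.derivCLM ℂ ℂ φ).decay 0 0
  refine (intervalIntegral.hasDerivAt_integral_of_dominated_loc_of_deriv_le
    (F' := fun t s => (SchwartzMap.derivCLM ℂ ℂ φ) (t - s) • F s)
    (bound := fun s => M * ‖F s‖) (Metric.ball_mem_nhds t one_pos)
    (.of_forall fun t => ((hφ φ t).def').aestronglyMeasurable) (hφ φ t)
    ((hφ _ t).def').aestronglyMeasurable (.of_forall fun s _ x _ => ?_)
    (hI.norm.const_mul M) (.of_forall fun s _ x _ => ?_)).2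
  · rw [norm_smul]
    gcongr
    simpa using hM (x - s)
  · have h1 : HasDerivAt φ (SchwartzMap.derivCLM ℂ ℂ φ (x - s)) (x - s) := by
      simpa using φ.differentiableAt.hasDerivAt
    have h2 := h1.scomp x ((hasDerivAt_id x).sub_const s)
    simpa using h2.smul_const (F s)

theorem exists_lipschitz_convS (hF : IsMeanBounded F) (φ : SchwartzMap ℝ ℂ) :
    ∃ L : ℝ, ∀ t u, ‖convS φ F t - convS φ F u‖ ≤ L * |t - u| := by
  obtain ⟨L, hL⟩ := hF.exists_bound (SchwartzMap.derivCLM ℂ ℂ φ)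
  refine ⟨L, fun t u => le_of_tendsto
    ((hF.regular.tendsto_intervalIntegral_convS φ t).sub
      (hF.regular.tendsto_intervalIntegral_convS φ u)).norm (.of_forall fun n => ?_)⟩
  have hn : (-(n : ℝ)) ≤ n := by linarith [Nat.cast_nonneg (α := ℝ) n]
  have := convex_univ.norm_image_sub_le_of_norm_hasDerivWithin_le
    (fun x _ => (hasDerivAt_intervalIntegral hF.regular.2.1 φ (-(n : ℝ)) n x).hasDerivWithinAt)
    (fun x _ => hL x _ _ hn) (Set.mem_univ u) (Set.mem_univ t)
  simpa using this

theorem continuous_convS (hF : IsMeanBounded F) (φ : SchwartzMap ℝ ℂ) :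
    Continuous fun t => convS φ F t := by
  obtain ⟨L, hL⟩ := hF.exists_lipschitz_convS φ
  refine (LipschitzWith.of_dist_le_mul (K := L.toNNReal) fun t u => ?_).continuous
  rw [dist_eq_norm, Real.dist_eq]
  refine (hL t u).trans ?_
  gcongr
  exact Real.le_coe_toNNReal L

/-- Associativity of convolution with Schwartz functions. -/
theorem convS_convolution [CompleteSpace X] (hF : IsMeanBounded F) (χ φ : SchwartzMap ℝ ℂ)
    (t : ℝ) :
    convS (SchwartzMap.convolution (ContinuousLinearMap.mul ℂ ℂ) χ φ) F t
      = ∫ u, χ u • convS φ F (t - u) := by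
  obtain ⟨K, hK⟩ := hF.exists_bound φ
  have hn : ∀ n : ℕ, (-(n : ℝ)) ≤ n := fun n => by linarith [Nat.cast_nonneg (α := ℝ) n]
  have hI : ∀ n : ℕ, Integrable F (volume.restrict (Set.Ioc (-(n : ℝ)) n)) := fun n =>
    (hF.regular.2.1.integrableOn_isCompact isCompact_Icc).mono_set Set.Ioc_subset_Icc_self
  have htrunc : ∀ n : ℕ,
      ∫ s in (-(n : ℝ))..n, SchwartzMap.convolution (ContinuousLinearMap.mul ℂ ℂ) χ φ (t - s) • F s
        = ∫ u, χ u • ∫ s in (-(n : ℝ))..n, φ (t - u - s) • F s := by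
    intro n
    obtain ⟨M, -, hM⟩ := φ.decay 0 0
    have hint : Integrable (fun p : ℝ × ℝ => φ (t - p.1 - p.2) • (χ p.1 • F p.2))
        (volume.prod (volume.restrict (Set.Ioc (-(n : ℝ)) n))) := by
      refine (χ.integrable.smul_prod (hI n)).bdd_smul M ?_ (.of_forall fun p => ?_)
      · exact (φ.continuous.comp (by fun_prop)).aestronglyMeasurable
      · simpa using hM (t - p.1 - p.2)
    have hswap := integral_integral_swap (f := fun u s => φ (t - u - s) • (χ u • F s)) hint
    simp_rw [intervalIntegral.integral_of_le (hn n)]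
    calc _ = ∫ s in Set.Ioc (-(n : ℝ)) n, ∫ u, φ (t - u - s) • (χ u • F s) := by
          congr 1
          ext s
          rw [SchwartzMap.convolution_apply, MeasureTheory.convolution_def]
          simp_rw [smul_smul]
          rw [integral_smul_const]
          congr 2
          ext u
          simp only [ContinuousLinearMap.mul_apply']
          rw [mul_comm, sub_right_comm]
      _ = _ := by
          rw [← hswap]
          congr 1
          ext u
          rw [← integral_smul]
          congr 1
          ext s
          rw [smul_comm]
  refine tendsto_nhds_unique (hF.regular.tendsto_intervalIntegral_convS _ t) ?_
  simp_rw [htrunc]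
  refine tendsto_integral_of_dominated_convergence (fun u => ‖χ u‖ * K) (fun n => ?_)
    (χ.integrable.norm.mul_const K) (fun n => .of_forall fun u => ?_)
    (.of_forall fun u => (hF.regular.tendsto_intervalIntegral_convS φ (t - u)).const_smul _)
  · have hc : Continuous fun t => ∫ s in (-(n : ℝ))..n, φ (t - s) • F s :=
      continuous_iff_continuousAt.2 fun x =>
        (hasDerivAt_intervalIntegral hF.regular.2.1 φ _ _ x).continuousAt
    exact (χ.continuous.smul (hc.comp (continuous_const.sub continuous_id))).aestronglyMeasurable
  · rw [norm_smul]
    gcongr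
    exact hK _ _ _ (hn n)

end IsMeanBounded

theorem IsCZero.integral_smul_sub [CompleteSpace X] {g : ℝ → X} (hg : IsCZero g) {χ : ℝ → ℂ}
    (hχ : Integrable χ) (hχc : Continuous χ) : IsCZero fun t => ∫ u, χ u • g (t - u) := by
  obtain ⟨C, hC⟩ : ∃ C, ∀ x, ‖g x‖ ≤ C := by
    obtain ⟨C, hC⟩ := (ZeroAtInftyContinuousMap.isBounded_range
      (⟨⟨g, hg.1⟩, tendsto_zero_iff_norm_tendsto_zero.2 hg.2⟩ :
        ZeroAtInftyContinuousMap ℝ X)).exists_norm_le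
    exact ⟨C, fun x => hC _ ⟨x, rfl⟩⟩
  have hmeas : ∀ t, AEStronglyMeasurable (fun u => χ u • g (t - u)) := fun t =>
    (hχc.smul (hg.1.comp (continuous_const.sub continuous_id))).aestronglyMeasurable
  have hbound : ∀ t u, ‖χ u • g (t - u)‖ ≤ ‖χ u‖ * C := fun t u => by
    rw [norm_smul]
    gcongr
    exact hC _
  refine ⟨continuous_of_dominated hmeas (fun t => .of_forall (hbound t))
    (hχ.norm.mul_const C) (.of_forall fun u => ?_), ?_⟩
  · exact (hg.1.comp (continuous_id.sub continuous_const)).const_smul _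
  · rw [← tendsto_zero_iff_norm_tendsto_zero]
    have : (cocompact ℝ).IsCountablyGenerated := by
      rw [cocompact_eq_atBot_atTop]; infer_instance
    have := tendsto_integral_filter_of_dominated_convergence (l := cocompact ℝ)
      (F := fun t u => χ u • g (t - u)) (f := fun _ => 0) (fun u => ‖χ u‖ * C)
      (.of_forall hmeas) (.of_forall fun t => .of_forall (hbound t)) (hχ.norm.mul_const C)
      (.of_forall fun u => ?_)
    · simpa using this
    · have h1 : Tendsto (fun t : ℝ => t - u) (cocompact ℝ) (cocompact ℝ) :=
        (Homeomorph.subRight u).isClosedEmbedding.tendsto_cocompact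
      have h2 := (tendsto_zero_iff_norm_tendsto_zero.2 hg.2).comp h1
      simpa using h2.const_smul (χ u)

end Convolution

theorem isCZero_of_forall_exists_norm_sub_le {X : Type*} [NormedAddCommGroup X] {f : ℝ → X}
    (h : ∀ ε > 0, ∃ g, IsCZero g ∧ ∀ t, ‖f t - g t‖ ≤ ε) : IsCZero f := by
  refine ⟨continuous_of_uniform_approx_of_continuous fun U hU => ?_, ?_⟩
  · obtain ⟨ε, hε, hεU⟩ := Metric.mem_uniformity_dist.1 hU
    obtain ⟨g, hg, hfg⟩ := h (ε / 2) (by positivity)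
    refine ⟨g, hg.1, fun t => hεU ?_⟩
    rw [dist_eq_norm]
    linarith [hfg t]
  · rw [← tendsto_zero_iff_norm_tendsto_zero, NormedAddGroup.tendsto_nhds_zero]
    intro ε hε
    obtain ⟨g, hg, hfg⟩ := h (ε / 2) (by positivity)
    filter_upwards [hg.2.eventually_lt_const (show 0 < ε / 2 by positivity)] with t ht
    have := norm_add_le (f t - g t) (g t)
    rw [sub_add_cancel] at this
    linarith [hfg t]

section Wiener

open FourierTransform ContDiff

/-- A set of Schwartz functions that is an ideal for pointwise multiplication and has no common
zero contains every compactly supported Schwartz function. -/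
theorem SchwartzMap.mem_of_hasCompactSupport {J : Set (SchwartzMap ℝ ℂ)} (h_zero : 0 ∈ J)
    (h_add : ∀ f ∈ J, ∀ g ∈ J, f + g ∈ J)
    (h_mul : ∀ f, ∀ g ∈ J, SchwartzMap.pairing (ContinuousLinearMap.mul ℂ ℂ) f g ∈ J)
    (h_ne : ∀ x, ∃ g ∈ J, g x ≠ 0) {η : SchwartzMap ℝ ℂ} (hη : HasCompactSupport η) : η ∈ J := by
  obtain ⟨g, hgJ, r, hgr, -, hr⟩ : ∃ g ∈ J, ∃ r : ℝ → ℝ,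
      (∀ x, g x = r x) ∧ (∀ x, 0 ≤ r x) ∧ ∀ x ∈ tsupport η, 0 < r x := by
    refine IsCompact.induction_on (p := fun s => ∃ g ∈ J, ∃ r : ℝ → ℝ,
      (∀ x, g x = r x) ∧ (∀ x, 0 ≤ r x) ∧ ∀ x ∈ s, 0 < r x) hη ?_ ?_ ?_ ?_
    · exact ⟨0, h_zero, 0, by simp, by simp, by simp⟩
    · rintro s t hst ⟨g, hg, r, h1, h2, h3⟩
      exact ⟨g, hg, r, h1, h2, fun x hx => h3 x (hst hx)⟩
    · rintro s t ⟨g, hg, r, h1, h2, h3⟩ ⟨g', hg', r', h1', h2', h3'⟩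
      refine ⟨g + g', h_add _ hg _ hg', r + r', fun x => by simp [h1, h1'],
        fun x => add_nonneg (h2 x) (h2' x), ?_⟩
      rintro x (hx | hx)
      · exact add_pos_of_pos_of_nonneg (h3 x hx) (h2' x)
      · exact add_pos_of_nonneg_of_pos (h2 x) (h3' x hx)
    · intro x _
      obtain ⟨g, hg, hgx⟩ := h_ne x
      refine ⟨{y | g y ≠ 0}, mem_nhdsWithin_of_mem_nhds
        ((isOpen_ne_fun g.continuous continuous_const).mem_nhds hgx),
        _, h_mul (SchwartzMap.postcompCLM (𝕜 := ℝ) (Complex.conjCLE : ℂ →L[ℝ] ℂ) g) g hg,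
        fun y => Complex.normSq (g y), fun y => ?_, fun y => Complex.normSq_nonneg _,
        fun y hy => Complex.normSq_pos.2 hy⟩
      rw [SchwartzMap.pairing_apply_apply, SchwartzMap.postcompCLM_apply]
      simpa using (Complex.normSq_eq_conj_mul_self (z := g y)).symm
  have hsmooth : ContDiff ℝ ∞ fun x => η x * (g x)⁻¹ := by
    refine contDiff_iff_contDiffAt.2 fun x => ?_
    by_cases hx : x ∈ tsupport η
    · have hgx : g x ≠ 0 := by
        rw [hgr]; exact_mod_cast (hr x hx).ne'
      exact (η.smooth ⊤).contDiffAt.mul ((g.smooth ⊤).contDiffAt.inv hgx)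
    · refine (contDiffAt_const (c := (0 : ℂ))).congr_of_eventuallyEq ?_
      filter_upwards [notMem_tsupport_iff_eventuallyEq.1 hx] with y hy
      simp [hy]
  have hsupp : HasCompactSupport fun x => η x * (g x)⁻¹ := hη.mul_right
  convert! h_mul (hsupp.toSchwartzMap hsmooth) g hgJ
  ext x
  rw [SchwartzMap.pairing_apply_apply]
  simp only [HasCompactSupport.toSchwartzMap_toFun, ContinuousLinearMap.mul_apply']
  by_cases hx : x ∈ tsupport η
  · have hgx : g x ≠ 0 := by
      rw [hgr]; exact_mod_cast (hr x hx).ne'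
    field_simp
  · simp [image_eq_zero_of_notMem_tsupport hx]

theorem fourierInt_eq_fourier (φ : SchwartzMap ℝ ℂ) (x : ℝ) :
    fourierInt φ (2 * Real.pi * x) = 𝓕 φ x := by
  rw [SchwartzMap.fourier_coe, Real.fourier_eq', fourierInt]
  congr 1
  ext t
  simp only [smul_eq_mul]
  congr 2
  simp
  ring

/-- There are Schwartz functions of integral `1` with compactly supported Fourier transform and
arbitrarily small first absolute moment. -/
theorem exists_fourierInv_hasCompactSupport_moment_le {ε : ℝ} (hε : 0 < ε) :
    ∃ η : SchwartzMap ℝ ℂ, HasCompactSupport η ∧ ∫ u, (𝓕⁻ η) u = 1 ∧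
      ∫ u, ‖(𝓕⁻ η) u‖ * |u| ≤ ε := by
  let β : ContDiffBump (0 : ℝ) := ⟨1, 2, one_pos, one_lt_two⟩
  have hβs : ContDiff ℝ ∞ fun x => ((β x : ℝ) : ℂ) := Complex.ofRealCLM.contDiff.comp β.contDiff
  have hβc : HasCompactSupport fun x => ((β x : ℝ) : ℂ) :=
    β.hasCompactSupport.comp_left Complex.ofReal_zero
  let η₁ : SchwartzMap ℝ ℂ := hβc.toSchwartzMap hβs
  set m : ℝ := ∫ u, ‖(𝓕⁻ η₁) u‖ * |u| with hm
  have hm0 : 0 ≤ m := integral_nonneg fun u => by positivity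
  set c : ℝ := m / ε + 1 with hc
  have hc0 : 0 < c := by positivity
  have hηs : ContDiff ℝ ∞ fun x => ((β (c⁻¹ * x) : ℝ) : ℂ) := by
    exact hβs.comp (contDiff_const.mul contDiff_id)
  have hηc : HasCompactSupport fun x => ((β (c⁻¹ * x) : ℝ) : ℂ) :=
    hβc.comp_homeomorph (Homeomorph.mulLeft₀ c⁻¹ (inv_ne_zero hc0.ne'))
  let η : SchwartzMap ℝ ℂ := hηc.toSchwartzMap hηs
  have hscale : ∀ x, (𝓕⁻ η) x = (c : ℂ) * (𝓕⁻ η₁) (c * x) := by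
    intro x
    rw [SchwartzMap.fourierInv_coe, SchwartzMap.fourierInv_coe, Real.fourierInv_eq',
      Real.fourierInv_eq']
    have := Measure.integral_comp_mul_left (fun v : ℝ =>
      Complex.exp (↑(2 * Real.pi * inner ℝ v (c * x)) * Complex.I) • η₁ v) c⁻¹
    rw [inv_inv, abs_of_pos hc0] at this
    rw [← Complex.real_smul, ← this]
    congr 1
    ext v
    have hv : c⁻¹ * v * (c * x) = v * x := by field_simp
    have hinner : inner ℝ (c⁻¹ * v) (c * x) = inner ℝ v x := by
      simpa [mul_comm] using hv
    rw [hinner]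
    rfl
  refine ⟨η, hηc, ?_, ?_⟩
  · have h1 : 𝓕 (𝓕⁻ η) 0 = (1 : ℂ) := by
      rw [FourierTransform.fourier_fourierInv_eq]
      simp [η, β.one_of_mem_closedBall (x := 0) (by simp [β])]
    rw [← h1, SchwartzMap.fourier_coe, Real.fourier_eq']
    simp
  · have h2 : ∀ u, ‖(𝓕⁻ η) u‖ * |u| = (fun v => ‖(𝓕⁻ η₁ : SchwartzMap ℝ ℂ) v‖ * |v|) (c * u) := by
      intro u
      simp only [hscale, norm_mul, Complex.norm_real, Real.norm_eq_abs, abs_mul]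
      ring
    simp_rw [h2]
    rw [Measure.integral_comp_mul_left (fun v => ‖(𝓕⁻ η₁ : SchwartzMap ℝ ℂ) v‖ * |v|) c, ← hm,
      abs_of_pos (inv_pos.2 hc0), smul_eq_mul, inv_mul_le_iff₀ hc0, hc, add_mul,
      div_mul_cancel₀ _ hε.ne']
    linarith

end Wiener

section Tauberian

open FourierTransform

variable {X : Type*} [NormedAddCommGroup X] [NormedSpace ℂ X] [CompleteSpace X] {F : ℝ → X}

theorem IsMeanBounded.isCZero_convS_fourierInv (hF : IsMeanBounded F)
    (hsp : ∀ ω : ℝ, ∃ φ : SchwartzMap ℝ ℂ,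
      fourierInt φ ω ≠ 0 ∧ IsCZero (fun t => convS φ F t))
    {η : SchwartzMap ℝ ℂ} (hη : HasCompactSupport η) : IsCZero fun t => convS (𝓕⁻ η : SchwartzMap ℝ ℂ) F t := by
  refine SchwartzMap.mem_of_hasCompactSupport
    (J := {η | IsCZero fun t => convS (𝓕⁻ η : SchwartzMap ℝ ℂ) F t}) ?_ ?_ ?_ ?_ hη
  · have h0 : 𝓕⁻ (0 : SchwartzMap ℝ ℂ) = 0 := FourierTransform.fourierInv_zero
    simp only [Set.mem_ofPred_eq, h0, IsCZero, convS]
    simpa using continuous_const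
  · intro f hf g hg
    have : ∀ t, convS (𝓕⁻ (f + g) : SchwartzMap ℝ ℂ) F t
        = convS (𝓕⁻ f : SchwartzMap ℝ ℂ) F t + convS (𝓕⁻ g : SchwartzMap ℝ ℂ) F t := by
      intro t
      simp only [convS, FourierTransform.fourierInv_add, add_apply, add_smul]
      exact integral_add (hF.regular.integrable_sub_smul _ t) (hF.regular.integrable_sub_smul _ t)
    simp only [Set.mem_ofPred_eq, this]
    refine ⟨hf.1.add hg.1, ?_⟩
    rw [← tendsto_zero_iff_norm_tendsto_zero]
    simpa using (tendsto_zero_iff_norm_tendsto_zero.2 hf.2).add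
      (tendsto_zero_iff_norm_tendsto_zero.2 hg.2)
  · intro f g hg
    have : 𝓕⁻ (SchwartzMap.pairing (ContinuousLinearMap.mul ℂ ℂ) f g)
        = SchwartzMap.convolution (ContinuousLinearMap.mul ℂ ℂ) (𝓕⁻ f) (𝓕⁻ g) := by
      rw [← FourierTransform.fourierInv_fourier_eq (F := SchwartzMap ℝ ℂ)
          (SchwartzMap.convolution _ _ _),
        SchwartzMap.fourier_convolution]
      simp
    simp only [Set.mem_ofPred_eq, this, hF.convS_convolution]
    exact IsCZero.integral_smul_sub hg (𝓕⁻ f).integrable (𝓕⁻ f).continuous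
  · intro x
    obtain ⟨φ, h1, h2⟩ := hsp (2 * Real.pi * x)
    rw [fourierInt_eq_fourier] at h1
    refine ⟨𝓕 φ, ?_, h1⟩
    simpa using h2

theorem IsMeanBounded.isCZero_convS (hF : IsMeanBounded F)
    (hsp : ∀ ω : ℝ, ∃ φ : SchwartzMap ℝ ℂ,
      fourierInt φ ω ≠ 0 ∧ IsCZero (fun t => convS φ F t))
    (ψ : SchwartzMap ℝ ℂ) : IsCZero fun t => convS ψ F t := by
  obtain ⟨C, hC⟩ := hF.exists_norm_convS_le ψ
  obtain ⟨L, hL⟩ := hF.exists_lipschitz_convS ψ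
  refine isCZero_of_forall_exists_norm_sub_le fun ε hε => ?_
  have hL0 : 0 ≤ L := by simpa using (norm_nonneg _).trans (hL 1 0)
  obtain ⟨η, hη, hone, hmom⟩ := exists_fourierInv_hasCompactSupport_moment_le
    (show 0 < ε / (L + 1) by positivity)
  set ρ : SchwartzMap ℝ ℂ := 𝓕⁻ η with hρ
  have hρη : 𝓕 ρ = η := by simp [hρ]
  refine ⟨fun t => convS (SchwartzMap.convolution (ContinuousLinearMap.mul ℂ ℂ) ρ ψ) F t, ?_,
    fun t => ?_⟩
  · rw [← FourierTransform.fourierInv_fourier_eq (F := SchwartzMap ℝ ℂ)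
        (SchwartzMap.convolution _ ρ ψ),
      SchwartzMap.fourier_convolution, hρη]
    refine hF.isCZero_convS_fourierInv hsp (hη.mono fun x hx => ?_)
    rw [Function.mem_support, SchwartzMap.pairing_apply_apply] at hx
    exact left_ne_zero_of_mul hx
  · have hint : Integrable fun u => ρ u • convS ψ F (t - u) := by
      refine (ρ.integrable.norm.mul_const C).mono' (ρ.continuous.smul
        ((hF.continuous_convS ψ).comp (continuous_const.sub continuous_id))).aestronglyMeasurable
        (.of_forall fun u => ?_)
      rw [norm_smul]
      gcongr
      exact hC _
    have hconst : convS ψ F t = ∫ u, ρ u • convS ψ F t := by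
      rw [integral_smul_const, hone, one_smul]
    have hdom : Integrable fun u => L * (‖ρ u‖ * |u|) := by
      refine Integrable.const_mul ((ρ.integrable_pow_mul volume 1).congr
        (.of_forall fun u => ?_)) L
      simp [mul_comm]
    simp only [hF.convS_convolution]
    rw [hconst, ← integral_sub (ρ.integrable.smul_const _) hint]
    calc ‖∫ u, (ρ u • convS ψ F t - ρ u • convS ψ F (t - u))‖ ≤ ∫ u, L * (‖ρ u‖ * |u|) := by
          refine norm_integral_le_of_norm_le hdom (.of_forall fun u => ?_)
          rw [← smul_sub, norm_smul]
          have := hL t (t - u)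
          rw [sub_sub_cancel] at this
          calc _ ≤ ‖ρ u‖ * (L * |u|) := by gcongr
            _ = _ := by ring
      _ = L * ∫ u, ‖ρ u‖ * |u| := integral_const_mul _ _
      _ ≤ (L + 1) * (ε / (L + 1)) := by gcongr; linarith
      _ = ε := mul_div_cancel₀ _ (by positivity)

end Tauberian

/-- If `F` is absolutely regular with `M_h F` bounded for all `h > 0`, and
every `ω ∈ ℝ` admits a Schwartz `φ` with `φ̂(ω) ≠ 0` and `F∗φ ∈ C₀(ℝ,X)`, then
`F∗ψ ∈ C₀(ℝ,X)` for every Schwartz `ψ`. -/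
theorem conv_mem_C0_of_empty_C0_spectrum {X : Type*} [NormedAddCommGroup X] [NormedSpace ℂ X]
    [CompleteSpace X] (F : ℝ → X) (hF : AbsolutelyRegular F)
    (hM : ∀ h : ℝ, 0 < h → ∃ C : ℝ, ∀ t : ℝ, ‖h⁻¹ • ∫ s in (0:ℝ)..h, F (t + s)‖ ≤ C)
    (hsp : ∀ ω : ℝ, ∃ φ : SchwartzMap ℝ ℂ,
      fourierInt (⇑φ) ω ≠ 0 ∧ IsCZero (fun t => convS (⇑φ) F t)) :
    ∀ ψ : SchwartzMap ℝ ℂ, IsCZero (fun t => convS (⇑ψ) F t) := by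
  obtain ⟨B, hB0, hB⟩ := exists_norm_intervalIntegral_le_of_bounded_mean hF.2.1 hM
  have hF' : IsMeanBounded F :=
    ⟨hF, exists_norm_intervalIntegral_sub_smul_le hF.2.1 hB0 hB⟩
  exact hF'.isCZero_convS hsp
end

section
/- Let X be a complex Banach space, let F : ℝ → X be absolutely regular, and let ψ be a Schwartz function such that ψ̂ is smooth with compact support. Suppose that for every ω in the support of ψ̂ there exists a Schwartz function φ with φ̂(ω) ≠ 0 such that F∗φ ∈ C₀(ℝ,X). Then F∗ψ ∈ C₀(ℝ,X). -/
open MeasureTheory Filter Topology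

section

open scoped FourierTransform SchwartzMap ContDiff

/-- A series of Schwartz functions whose seminorms are all summable has a Schwartz sum. -/
theorem SchwartzMap.exists_hasSum_apply {f : ℕ → 𝓢(ℝ, ℂ)}
    (hf : ∀ p q, Summable fun k => SchwartzMap.seminorm ℝ p q (f k)) :
    ∃ Φ : 𝓢(ℝ, ℂ), ∀ t, HasSum (fun k => f k t) (Φ t) := by
  have hsmooth : ∀ i, ContDiff ℝ ((⊤ : ℕ∞) : WithTop ℕ∞) (f i) := fun i => (f i).smooth ⊤
  have hbound : ∀ (q i : ℕ) (t : ℝ), (q : ℕ∞) ≤ ⊤ →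
      ‖iteratedFDeriv ℝ q (f i) t‖ ≤ SchwartzMap.seminorm ℝ 0 q (f i) := fun q i t _ =>
    (f i).norm_iteratedFDeriv_le_seminorm ℝ q t
  refine ⟨⟨fun t => ∑' k, f k t, ?_, ?_⟩, ?_⟩
  · exact contDiff_tsum hsmooth (fun q _ => hf 0 q) hbound
  · intro p q
    refine ⟨∑' k, SchwartzMap.seminorm ℝ p q (f k), fun t => ?_⟩
    rw [iteratedFDeriv_tsum_apply hsmooth (fun q _ => hf 0 q) hbound le_top t]
    have hs : Summable fun k => ‖iteratedFDeriv ℝ q (f k) t‖ :=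
      Summable.of_nonneg_of_le (fun _ => norm_nonneg _) (fun k => hbound q k t le_top) (hf 0 q)
    calc ‖t‖ ^ p * ‖∑' k, iteratedFDeriv ℝ q (f k) t‖
        ≤ ‖t‖ ^ p * ∑' k, ‖iteratedFDeriv ℝ q (f k) t‖ := by
          gcongr
          exact norm_tsum_le_tsum_norm hs
      _ = ∑' k, ‖t‖ ^ p * ‖iteratedFDeriv ℝ q (f k) t‖ := tsum_mul_left.symm
      _ ≤ _ := (hs.mul_left _).tsum_le_tsum (fun k => (f k).le_seminorm ℝ p q t) (hf p q)
  · intro t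
    refine Summable.hasSum (Summable.of_norm_bounded (hf 0 0) fun k => ?_)
    exact (f k).norm_le_seminorm ℝ t

/-- Dilating by `r ≥ 1` multiplies the Schwartz seminorm of order `(p, q)` by at most `r ^ p`. -/
theorem SchwartzMap.exists_dilation (g : 𝓢(ℝ, ℂ)) {r : ℝ} (hr : 1 ≤ r) :
    ∃ f : 𝓢(ℝ, ℂ), (∀ t, f t = g (r⁻¹ * t)) ∧
      ∀ p q, SchwartzMap.seminorm ℝ p q f ≤ r ^ p * SchwartzMap.seminorm ℝ p q g := by
  have hr0 : r ≠ 0 := by positivity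
  let e : ℝ ≃L[ℝ] ℝ := ContinuousLinearEquiv.smulLeft (Units.mk0 r⁻¹ (inv_ne_zero hr0))
  let f : 𝓢(ℝ, ℂ) := SchwartzMap.compCLMOfContinuousLinearEquiv ℝ e g
  have hf : (f : ℝ → ℂ) = fun t => g (r⁻¹ * t) := by
    ext t
    rfl
  refine ⟨f, fun t => congrFun hf t, fun p q => ?_⟩
  refine f.seminorm_le_bound' ℝ p q (by positivity) fun t => ?_
  rw [hf, iteratedDeriv_comp_const_smul ((g.smooth ⊤).of_le (by exact_mod_cast le_top))]
  have h1 := g.le_seminorm' ℝ p q (r⁻¹ * t)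
  have h2 : |r⁻¹| ^ q ≤ 1 := by
    apply pow_le_one₀ (abs_nonneg _)
    rw [abs_of_nonneg (by positivity)]
    exact inv_le_one_of_one_le₀ hr
  have h3 : |t| ^ p = r ^ p * |r⁻¹ * t| ^ p := by
    rw [← mul_pow, abs_mul, abs_of_nonneg (by positivity : 0 ≤ r⁻¹), mul_inv_cancel_left₀ hr0]
  calc |t| ^ p * ‖r⁻¹ ^ q • iteratedDeriv q g (r⁻¹ * t)‖
      = |r⁻¹| ^ q * (r ^ p * (|r⁻¹ * t| ^ p * ‖iteratedDeriv q g (r⁻¹ * t)‖)) := by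
        rw [norm_smul, norm_pow, Real.norm_eq_abs, h3]
        ring
    _ ≤ 1 * (r ^ p * SchwartzMap.seminorm ℝ p q g) := by gcongr
    _ = _ := one_mul _

/-- The modulus of a Schwartz function is dominated by a nonnegative Schwartz function. -/
theorem SchwartzMap.exists_nonneg_dominating (φ : 𝓢(ℝ, ℂ)) :
    ∃ Φ : 𝓢(ℝ, ℂ), ∀ t, Φ t = (‖Φ t‖ : ℂ) ∧ ‖φ t‖ ≤ ‖Φ t‖ := by
  let b : ContDiffBump (0 : ℝ) := ⟨1, 2, one_pos, one_lt_two⟩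
  have hbs : HasCompactSupport fun t => (b t : ℂ) :=
    b.hasCompactSupport.comp_left (g := ((↑) : ℝ → ℂ)) Complex.ofReal_zero
  have hbd : ContDiff ℝ ∞ fun t => (b t : ℂ) := Complex.ofRealCLM.contDiff.comp b.contDiff
  let g : 𝓢(ℝ, ℂ) := hbs.toSchwartzMap hbd
  have hg : ∀ t, g t = (b t : ℂ) := fun t => rfl
  choose d hd hdb using fun k : ℕ =>
    g.exists_dilation (r := (k : ℝ) + 1) (by linarith [k.cast_nonneg (α := ℝ)])
  choose C hC using fun p => show ∃ C, ∀ t, (1 + ‖t‖) ^ p * ‖φ t‖ ≤ C from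
    ⟨_, fun t => by
      simpa using SchwartzMap.one_add_le_sup_seminorm_apply (𝕜 := ℝ) (m := (p, 0))
        (k := p) (n := 0) le_rfl le_rfl φ t⟩
  let w : ℕ → ℝ := fun k => ⨆ t : {t : ℝ // (k : ℝ) ≤ ‖t‖}, ‖φ t‖
  have hbdd : ∀ k : ℕ, BddAbove (Set.range fun t : {t : ℝ // (k : ℝ) ≤ ‖t‖} => ‖φ t‖) := fun k =>
    ⟨C 0, by rintro _ ⟨t, rfl⟩; simpa using hC 0 t⟩
  have hw0 : ∀ k, 0 ≤ w k := fun k => Real.iSup_nonneg fun _ => norm_nonneg _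
  have hwC : ∀ (p k : ℕ), ((k : ℝ) + 1) ^ p * w k ≤ C p := by
    intro p (k : ℕ)
    have : Nonempty {t : ℝ // (k : ℝ) ≤ ‖t‖} := ⟨⟨(k : ℝ), by simp⟩⟩
    have hk : (0 : ℝ) < (k + 1) ^ p := by positivity
    rw [← le_div_iff₀' hk]
    refine ciSup_le fun t => ?_
    rw [le_div_iff₀' hk]
    refine le_trans ?_ (hC p t)
    rw [add_comm (k : ℝ) 1]
    gcongr
    exact t.2
  obtain ⟨Φ, hΦ⟩ := SchwartzMap.exists_hasSum_apply (f := fun k => w k • d k) (by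
    intro p q
    have hs : Summable fun k : ℕ => C (p + 2) * SchwartzMap.seminorm ℝ p q g *
        (1 / ((k : ℝ) + 1) ^ 2) := by
      refine Summable.mul_left _ ?_
      exact_mod_cast (summable_nat_add_iff 1).2 (Real.summable_one_div_nat_pow.2 one_lt_two)
    refine hs.of_nonneg_of_le (fun k => apply_nonneg _ _) fun k => ?_
    rw [map_smul_eq_mul, Real.norm_of_nonneg (hw0 k), mul_one_div, le_div_iff₀ (by positivity)]
    calc w k * SchwartzMap.seminorm ℝ p q (d k) * ((k : ℝ) + 1) ^ 2
        ≤ w k * (((k : ℝ) + 1) ^ p * SchwartzMap.seminorm ℝ p q g) * ((k : ℝ) + 1) ^ 2 := by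
          gcongr
          · exact hw0 k
          · exact hdb k p q
      _ = (((k : ℝ) + 1) ^ (p + 2) * w k) * SchwartzMap.seminorm ℝ p q g := by ring
      _ ≤ _ := by gcongr; exact hwC _ _)
  have hterm : ∀ k t, (w k • d k) t = ((w k * b (((k : ℝ) + 1)⁻¹ * t) : ℝ) : ℂ) := by
    intro k t
    simp [hd, hg]
  refine ⟨Φ, fun t => ?_⟩
  have hsum : HasSum (fun k => w k * b (((k : ℝ) + 1)⁻¹ * t)) (Φ t).re := by
    simpa only [hterm, Complex.ofReal_re] using Complex.hasSum_re (hΦ t)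
  have hnn : ∀ k, 0 ≤ w k * b (((k : ℝ) + 1)⁻¹ * t) := fun k => mul_nonneg (hw0 k) b.nonneg
  have hreal : Φ t = ((Φ t).re : ℂ) := by
    refine (hΦ t).unique ?_
    simpa only [hterm] using Complex.hasSum_ofReal.2 hsum
  have hre : ‖Φ t‖ = (Φ t).re := by
    rw [hreal, Complex.norm_real, Complex.ofReal_re, Real.norm_of_nonneg (hsum.nonneg hnn)]
  rw [hre]
  refine ⟨hreal, le_trans ?_ (le_hasSum hsum ⌊‖t‖⌋₊ fun k _ => hnn k)⟩
  have h1 : b (((⌊‖t‖⌋₊ : ℝ) + 1)⁻¹ * t) = 1 := by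
    apply b.one_of_mem_closedBall
    rw [mem_closedBall_zero_iff, norm_mul, norm_inv, Real.norm_of_nonneg (by positivity),
      inv_mul_le_iff₀ (by positivity)]
    simpa [b] using (Nat.lt_floor_add_one ‖t‖).le
  rw [h1, mul_one]
  exact le_ciSup (hbdd _) ⟨t, Nat.floor_le (norm_nonneg t)⟩

theorem IsCZero.sum {X ι : Type*} [NormedAddCommGroup X] (T : Finset ι) {G : ι → ℝ → X} (hG : ∀ i ∈ T, IsCZero (G i)) :
    IsCZero fun t => ∑ i ∈ T, G i t := by
  refine ⟨continuous_finsetSum T fun i hi => (hG i hi).1, ?_⟩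
  rw [← tendsto_zero_iff_norm_tendsto_zero, ← Finset.sum_const_zero (s := T)]
  exact tendsto_finsetSum T fun i hi => tendsto_zero_iff_norm_tendsto_zero.2 (hG i hi).2

section

variable {X : Type*} [NormedAddCommGroup X] [NormedSpace ℂ X]

/-- The convolution of an absolutely regular function with Schwartz functions is absolutely
convergent as a double integral. -/
theorem AbsolutelyRegular.integrable_prod {F : ℝ → X} (hF : AbsolutelyRegular F)
    (φ χ : 𝓢(ℝ, ℂ)) (t : ℝ) :
    Integrable (fun p : ℝ × ℝ => (χ p.2 * φ (t - p.1 - p.2)) • F p.1) (volume.prod volume) := by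
  obtain ⟨Φ, hΦ⟩ := φ.exists_nonneg_dominating
  obtain ⟨Y, hY⟩ := χ.exists_nonneg_dominating
  let η : 𝓢(ℝ, ℂ) := SchwartzMap.convolution (ContinuousLinearMap.mul ℂ ℂ) Y Φ
  have hη : ∀ x, η x = ((∫ u, ‖Y u‖ * ‖Φ (x - u)‖ : ℝ) : ℂ) := by
    intro x
    rw [SchwartzMap.convolution_apply, convolution_def, ← integral_complex_ofReal]
    congr 1
    ext u
    rw [ContinuousLinearMap.mul_apply', (hY u).1, (hΦ (x - u)).1]
    simp
  have hint : ∀ f g : 𝓢(ℝ, ℂ), ∀ x, Integrable fun u => f u * g (x - u) := by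
    intro f g x
    refine f.integrable.mul_bdd (c := SchwartzMap.seminorm ℝ 0 0 g) ?_
      (ae_of_all _ fun u => g.norm_le_seminorm ℝ _)
    exact (g.continuous.comp (by fun_prop)).aestronglyMeasurable
  have hmeas : AEStronglyMeasurable
      (fun p : ℝ × ℝ => (χ p.2 * φ (t - p.1 - p.2)) • F p.1) (volume.prod volume) := by
    refine AEStronglyMeasurable.smul ?_ (hF.1.comp_measurable measurable_fst).aestronglyMeasurable
    exact ((χ.continuous.comp (by fun_prop)).mul
      (φ.continuous.comp (by fun_prop))).aestronglyMeasurable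
  rw [integrable_prod_iff hmeas]
  refine ⟨ae_of_all _ fun s => (hint χ φ (t - s)).smul_const (F s), ?_⟩
  let ηt : 𝓢(ℝ, ℂ) := SchwartzMap.compCLMOfContinuousLinearEquiv ℝ
    (ContinuousLinearEquiv.neg ℝ) (SchwartzMap.compSubConstCLM ℝ (-t) η)
  have hηt : ∀ s, ηt s = η (t - s) := fun s => by
    simp [ηt, sub_eq_add_neg, add_comm]
  refine (hF.2.2 ηt).norm.mono hmeas.norm.integral_prod_right' (ae_of_all _ fun s => ?_)
  simp only [norm_smul]
  rw [hηt, integral_mul_const, norm_mul, norm_norm, norm_mul, norm_norm, norm_norm, hη,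
    Complex.norm_real]
  gcongr
  rw [Real.norm_of_nonneg (by positivity), Real.norm_of_nonneg (by positivity)]
  refine integral_mono (hint χ φ (t - s)).norm ?_ fun u => ?_
  · simpa using (hint Y Φ (t - s)).norm
  · simp only [norm_mul]
    exact mul_le_mul (hY u).2 (hΦ _).2 (norm_nonneg _) (norm_nonneg _)

/-- Associativity of the convolution of an absolutely regular function with two Schwartz
functions. -/
theorem AbsolutelyRegular.convS_convolution [CompleteSpace X] {F : ℝ → X}
    (hF : AbsolutelyRegular F) (φ χ : 𝓢(ℝ, ℂ)) (t : ℝ) :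
    convS (SchwartzMap.convolution (ContinuousLinearMap.mul ℂ ℂ) χ φ) F t =
      ∫ u, χ u • convS φ F (t - u) := by
  calc convS (SchwartzMap.convolution (ContinuousLinearMap.mul ℂ ℂ) χ φ) F t
      = ∫ s, ∫ u, (χ u * φ (t - s - u)) • F s := by
        refine integral_congr_ae (ae_of_all _ fun s => ?_)
        simp only [SchwartzMap.convolution_apply, convolution_def,
          ContinuousLinearMap.mul_apply']
        rw [integral_smul_const]
    _ = ∫ u, ∫ s, (χ u * φ (t - s - u)) • F s :=
        integral_integral_swap (hF.integrable_prod φ χ t)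
    _ = _ := by
        refine integral_congr_ae (ae_of_all _ fun u => ?_)
        simp only [mul_smul, convS, sub_right_comm t u]
        rw [integral_smul]

/-- Convolution with an integrable function preserves `C₀`. -/
theorem IsCZero.integral_smul {G : ℝ → X} (hG : IsCZero G) {χ : ℝ → ℂ} (hχ : Integrable χ) :
    IsCZero fun t => ∫ u, χ u • G (t - u) := by
  obtain ⟨hc, h0⟩ := hG
  let G₀ : ZeroAtInftyContinuousMap ℝ X := ⟨⟨G, hc⟩, tendsto_zero_iff_norm_tendsto_zero.2 h0⟩
  obtain ⟨C, hC⟩ : ∃ C, ∀ t, ‖G t‖ ≤ C := ⟨‖G₀.toBCF‖, G₀.toBCF.norm_coe_le_norm⟩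
  have hmeas : ∀ t, AEStronglyMeasurable (fun u => χ u • G (t - u)) := fun t =>
    hχ.aestronglyMeasurable.smul (hc.comp (by fun_prop)).aestronglyMeasurable
  have hbound : ∀ t, ∀ᵐ u, ‖χ u • G (t - u)‖ ≤ ‖χ u‖ * C := fun t => ae_of_all _ fun u => by
    rw [norm_smul]
    gcongr
    exact hC _
  refine ⟨continuous_of_dominated hmeas hbound (hχ.norm.mul_const C)
    (ae_of_all _ fun u => by fun_prop), ?_⟩
  rw [← tendsto_zero_iff_norm_tendsto_zero, ← integral_zero ℝ X (μ := volume)]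
  have : IsCountablyGenerated (cocompact ℝ) := by
    rw [cocompact_eq_atBot_atTop]
    infer_instance
  refine tendsto_integral_filter_of_dominated_convergence _ (Eventually.of_forall hmeas)
    (Eventually.of_forall hbound) (hχ.norm.mul_const C) (ae_of_all _ fun u => ?_)
  have : Tendsto (fun t => G (t - u)) (cocompact ℝ) (𝓝 0) :=
    (tendsto_zero_iff_norm_tendsto_zero.2 h0).comp
      (Homeomorph.subRight u).isClosedEmbedding.tendsto_cocompact
  simpa using this.const_smul (χ u)

theorem AbsolutelyRegular.convS_sum {F : ℝ → X} (hF : AbsolutelyRegular F) {ι : Type*}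
    (T : Finset ι) (f : ι → 𝓢(ℝ, ℂ)) (t : ℝ) :
    convS (∑ i ∈ T, f i : 𝓢(ℝ, ℂ)) F t = ∑ i ∈ T, convS (f i) F t := by
  simp only [convS, sum_apply, Finset.sum_smul]
  refine integral_finsetSum T fun i _ => ?_
  have h := hF.2.2 (SchwartzMap.compCLMOfContinuousLinearEquiv ℝ
    (ContinuousLinearEquiv.neg ℝ) (SchwartzMap.compSubConstCLM ℝ (-t) (f i)))
  simpa [sub_eq_add_neg, add_comm] using h

end

theorem fourierInt_two_pi_mul (φ : 𝓢(ℝ, ℂ)) (ξ : ℝ) :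
    fourierInt φ (2 * Real.pi * ξ) = 𝓕 φ ξ := by
  rw [SchwartzMap.fourier_coe, Real.fourier_real_eq_integral_exp_smul]
  refine integral_congr_ae (ae_of_all _ fun t => ?_)
  simp only [smul_eq_mul]
  congr 2
  push_cast
  ring

/-- A Schwartz function `ψ` with compactly supported Fourier transform is a finite sum of
convolutions `χ ∗ φ`, where the `φ` are taken from a family of Schwartz functions whose Fourier
transforms have no common zero on the support of `𝓕 ψ`. -/
theorem SchwartzMap.exists_eq_sum_convolution {P : 𝓢(ℝ, ℂ) → Prop} (ψ : 𝓢(ℝ, ℂ))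
    (hψ : HasCompactSupport (𝓕 ψ : 𝓢(ℝ, ℂ)))
    (hP : ∀ ξ ∈ tsupport (𝓕 ψ : 𝓢(ℝ, ℂ)), ∃ φ : 𝓢(ℝ, ℂ), 𝓕 φ ξ ≠ 0 ∧ P φ) :
    ∃ (T : Finset (tsupport (𝓕 ψ : 𝓢(ℝ, ℂ)))) (χ φ : tsupport (𝓕 ψ : 𝓢(ℝ, ℂ)) → 𝓢(ℝ, ℂ)),
      (∀ i, P (φ i)) ∧
      ψ = ∑ i ∈ T, SchwartzMap.convolution (ContinuousLinearMap.mul ℂ ℂ) (χ i) (φ i) := by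
  choose φ hφ hPφ using fun i : tsupport (𝓕 ψ : 𝓢(ℝ, ℂ)) => hP i i.2
  obtain ⟨T, hT⟩ := hψ.isCompact.elim_finite_subcover (fun i => {ξ | 𝓕 (φ i) ξ ≠ 0})
    (fun i => isOpen_ne_fun (𝓕 (φ i)).continuous continuous_const)
    (fun ξ hξ => Set.mem_iUnion.2 ⟨⟨ξ, hξ⟩, hφ ⟨ξ, hξ⟩⟩)
  let D : ℝ → ℂ := fun ξ => ∑ j ∈ T, (starRingEnd ℂ) (𝓕 (φ j) ξ) * 𝓕 (φ j) ξ
  have hconj : ∀ i, ContDiff ℝ ∞ fun ξ => (starRingEnd ℂ) (𝓕 (φ i) ξ) := fun i =>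
    Complex.conjCLE.contDiff.comp ((𝓕 (φ i)).smooth ⊤)
  have hDs : ContDiff ℝ ∞ D := ContDiff.sum fun j _ => (hconj j).mul ((𝓕 (φ j)).smooth ⊤)
  have hD0 : ∀ ξ ∈ tsupport (𝓕 ψ : 𝓢(ℝ, ℂ)), D ξ ≠ 0 := by
    intro ξ hξ
    obtain ⟨j, hj, hjξ⟩ := by simpa only [Set.mem_iUnion, exists_prop] using hT hξ
    have hD : D ξ = ((∑ j ∈ T, Complex.normSq (𝓕 (φ j) ξ) : ℝ) : ℂ) := by
      simp only [D, Complex.ofReal_sum, Complex.normSq_eq_conj_mul_self]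
    rw [hD, Complex.ofReal_ne_zero]
    exact (Finset.sum_pos' (f := fun i => Complex.normSq (𝓕 (φ i) ξ))
      (fun _ _ => Complex.normSq_nonneg _)
      ⟨j, hj, Complex.normSq_pos.2 hjξ⟩).ne'
  let m : tsupport (𝓕 ψ : 𝓢(ℝ, ℂ)) → ℝ → ℂ := fun i ξ =>
    (starRingEnd ℂ) (𝓕 (φ i) ξ) * (D ξ)⁻¹ * 𝓕 ψ ξ
  have hmc : ∀ i, HasCompactSupport (m i) := fun i => hψ.mul_left
  have hms : ∀ i, ContDiff ℝ ∞ (m i) := by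
    intro i
    rw [contDiff_iff_contDiffAt]
    intro ξ
    by_cases hξ : ξ ∈ tsupport (𝓕 ψ : 𝓢(ℝ, ℂ))
    · exact ((hconj i).contDiffAt.mul (hDs.contDiffAt.inv (hD0 ξ hξ))).mul
        ((𝓕 ψ).smooth ⊤).contDiffAt
    · refine (contDiffAt_const (c := (0 : ℂ))).congr_of_eventuallyEq ?_
      filter_upwards [notMem_tsupport_iff_eventuallyEq.1 hξ] with x hx
      simp only [m, hx, Pi.zero_apply, mul_zero]
  refine ⟨T, fun i => 𝓕⁻ ((hmc i).toSchwartzMap (hms i)), φ, hPφ, ?_⟩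
  have hinj : Function.Injective (𝓕 : 𝓢(ℝ, ℂ) → 𝓢(ℝ, ℂ)) := fun f g h => by
    simpa using congrArg (𝓕⁻ : 𝓢(ℝ, ℂ) → 𝓢(ℝ, ℂ)) h
  apply hinj
  rw [FourierTransform.fourier_sum]
  ext ξ
  simp only [SchwartzMap.fourier_convolution, sum_apply,
    SchwartzMap.pairing_apply_apply, FourierTransform.fourier_fourierInv_eq,
    ContinuousLinearMap.mul_apply']
  have hm : ∀ i, (hmc i).toSchwartzMap (hms i) ξ = m i ξ := fun i => rfl
  simp only [hm]
  by_cases hξ : ξ ∈ tsupport (𝓕 ψ : 𝓢(ℝ, ℂ))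
  · calc 𝓕 ψ ξ = D ξ / D ξ * 𝓕 ψ ξ := by rw [div_self (hD0 ξ hξ), one_mul]
      _ = _ := by
        conv_lhs => rw [show D ξ / D ξ = (∑ j ∈ T, (starRingEnd ℂ) (𝓕 (φ j) ξ) * 𝓕 (φ j) ξ) / D ξ
          from rfl]
        rw [Finset.sum_div, Finset.sum_mul]
        refine Finset.sum_congr rfl fun i _ => ?_
        simp only [m]
        ring
  · simp [m, image_eq_zero_of_notMem_tsupport hξ]

end

/-- If `F` is absolutely regular, `ψ` is Schwartz with `ψ̂` smooth of
compact support, and every `ω` in the support of `ψ̂` admits a Schwartz `φ` with `φ̂(ω) ≠ 0`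
and `F∗φ ∈ C₀(ℝ,X)`, then `F∗ψ ∈ C₀(ℝ,X)`. -/
theorem conv_mem_C0_of_spectrum_disjoint {X : Type*} [NormedAddCommGroup X] [NormedSpace ℂ X]
    [CompleteSpace X] (F : ℝ → X) (hF : AbsolutelyRegular F) (ψ : SchwartzMap ℝ ℂ)
    (hψ₁ : ContDiff ℝ (⊤ : ℕ∞) (fun ω => fourierInt (⇑ψ) ω))
    (hψ₂ : HasCompactSupport (fun ω => fourierInt (⇑ψ) ω))
    (hsp : ∀ ω ∈ tsupport (fun ω => fourierInt (⇑ψ) ω), ∃ φ : SchwartzMap ℝ ℂ,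
      fourierInt (⇑φ) ω ≠ 0 ∧ IsCZero (fun t => convS (⇑φ) F t)) :
    IsCZero (fun t => convS (⇑ψ) F t) := by
  have hcomp : (FourierTransform.fourier ψ : SchwartzMap ℝ ℂ) = fourierInt ψ ∘ Homeomorph.mulLeft₀ (2 * Real.pi)
      Real.two_pi_pos.ne' := funext fun ξ => (fourierInt_two_pi_mul ψ ξ).symm
  obtain ⟨T, χ, φ, hφ, hψ⟩ := ψ.exists_eq_sum_convolution
    (P := fun φ => IsCZero fun t => convS φ F t)
    (by rw [hcomp]; exact hψ₂.comp_homeomorph _)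
    (by
      intro ξ hξ
      rw [hcomp, tsupport_comp_eq_preimage] at hξ
      obtain ⟨φ, h1, h2⟩ := hsp _ hξ
      exact ⟨φ, by rw [← fourierInt_two_pi_mul]; exact h1, h2⟩)
  rw [hψ]
  simp only [hF.convS_sum, hF.convS_convolution]
  exact IsCZero.sum T fun i _ => (hφ i).integral_smul (χ i).integrable
end
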